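/- arXiv:hep-th/0210087 — 6 statements merged into one kernel-verified Lean document; each statement's English description precedes it below -/
import Mathlib

section
/- For every integer P ≥ 1, every p ∈ ℕ and every q ∈ ℂ with q ≠ 0, the constant matrices R and S = R^{ι^p} satisfy the first modified Yang–Baxter equation R₁₂·S₁₃·R₂₃ = S₂₃·R₁₃·S₁₂, an equality of operators on ℂ²⊗ℂ²⊗ℂ². -/
open Complex

/-- Index type for `ℂ²⊗ℂ²` with ordered basis `(e₀⊗e₀, e₀⊗e₁, e₁⊗e₀, e₁⊗e₁)`. -/
abbrev V2 : Type := Fin 2 × Fin 2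

/-- Index type for `ℂ²⊗ℂ²⊗ℂ²`. -/
abbrev V3 : Type := Fin 2 × Fin 2 × Fin 2

/-- The constant `R`-matrix `R^{ι^p}`: nonzero entries
`[1,1] = [4,4] = q`, `[2,2] = ε^p`, `[3,3] = ε^{−p}`, `[3,2] = q − q⁻¹`. -/
noncomputable def Rconst (ε q : ℂ) (p : ℕ) : Matrix V2 V2 ℂ :=
  Matrix.of fun x y =>
    if x = (0, 0) ∧ y = (0, 0) then q
    else if x = (1, 1) ∧ y = (1, 1) then q
    else if x = (0, 1) ∧ y = (0, 1) then ε ^ p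
    else if x = (1, 0) ∧ y = (1, 0) then (ε ^ p)⁻¹
    else if x = (1, 0) ∧ y = (0, 1) then q - q⁻¹
    else 0

/-- The spectral-parameter dependent `R`-matrix `R^{ι^p}(u)`: nonzero entries
`[1,1] = [4,4] = sin(λ+u)`, `[2,2] = ε^p·sin u`, `[3,3] = ε^{−p}·sin u`,
`[2,3] = e^{−iu}·sin λ`, `[3,2] = e^{iu}·sin λ`. -/
noncomputable def Rspec (ε lam : ℂ) (p : ℕ) (u : ℂ) : Matrix V2 V2 ℂ :=
  Matrix.of fun x y =>
    if x = (0, 0) ∧ y = (0, 0) then Complex.sin (lam + u)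
    else if x = (1, 1) ∧ y = (1, 1) then Complex.sin (lam + u)
    else if x = (0, 1) ∧ y = (0, 1) then ε ^ p * Complex.sin u
    else if x = (1, 0) ∧ y = (1, 0) then (ε ^ p)⁻¹ * Complex.sin u
    else if x = (0, 1) ∧ y = (1, 0) then Complex.exp (-(Complex.I * u)) * Complex.sin lam
    else if x = (1, 0) ∧ y = (0, 1) then Complex.exp (Complex.I * u) * Complex.sin lam
    else 0

/-- The flip operator `Π` on `ℂ²⊗ℂ²`. -/
def flipM : Matrix V2 V2 ℂ :=
  Matrix.of fun x y => if x.1 = y.2 ∧ x.2 = y.1 then 1 else 0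

/-- `X_{12}`: `X` acting on tensor factors 1 and 2 of `ℂ²⊗ℂ²⊗ℂ²`. -/
def op12 (X : Matrix V2 V2 ℂ) : Matrix V3 V3 ℂ :=
  Matrix.of fun x y => X (x.1, x.2.1) (y.1, y.2.1) * (if x.2.2 = y.2.2 then 1 else 0)

/-- `X_{13}`: `X` acting on tensor factors 1 and 3. -/
def op13 (X : Matrix V2 V2 ℂ) : Matrix V3 V3 ℂ :=
  Matrix.of fun x y => X (x.1, x.2.2) (y.1, y.2.2) * (if x.2.1 = y.2.1 then 1 else 0)

/-- `X_{23}`: `X` acting on tensor factors 2 and 3. -/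
def op23 (X : Matrix V2 V2 ℂ) : Matrix V3 V3 ℂ :=
  Matrix.of fun x y => X (x.2.1, x.2.2) (y.2.1, y.2.2) * (if x.1 = y.1 then 1 else 0)

/-- `X_{21}`: first matrix index of `X` on factor 2, second on factor 1. -/
def op21 (X : Matrix V2 V2 ℂ) : Matrix V3 V3 ℂ :=
  Matrix.of fun x y => X (x.2.1, x.1) (y.2.1, y.1) * (if x.2.2 = y.2.2 then 1 else 0)

/-- `X_{31}`: first matrix index of `X` on factor 3, second on factor 1. -/
def op31 (X : Matrix V2 V2 ℂ) : Matrix V3 V3 ℂ :=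
  Matrix.of fun x y => X (x.2.2, x.1) (y.2.2, y.1) * (if x.2.1 = y.2.1 then 1 else 0)

/-- `X_{32}`: first matrix index of `X` on factor 3, second on factor 2. -/
def op32 (X : Matrix V2 V2 ℂ) : Matrix V3 V3 ℂ :=
  Matrix.of fun x y => X (x.2.2, x.2.1) (y.2.2, y.2.1) * (if x.1 = y.1 then 1 else 0)

theorem op12_mul_op13_mul_op23_apply (A B C : Matrix V2 V2 ℂ) (a b c d e f : Fin 2) :
    (op12 A * op13 B * op23 C) (a, b, c) (d, e, f) =
      ∑ i, ∑ j, ∑ k, A (a, b) (i, j) * B (i, c) (d, k) * C (j, k) (e, f) := by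
  simp [Matrix.mul_apply, Fintype.sum_prod_type, op12, op13, op23]
  fin_cases c <;> fin_cases d <;> simp <;> ring

theorem op23_mul_op13_mul_op12_apply (A B C : Matrix V2 V2 ℂ) (a b c d e f : Fin 2) :
    (op23 A * op13 B * op12 C) (a, b, c) (d, e, f) =
      ∑ i, ∑ j, ∑ k, A (b, c) (j, k) * B (a, k) (i, f) * C (i, j) (d, e) := by
  simp [Matrix.mul_apply, Fintype.sum_prod_type, op12, op13, op23]
  fin_cases a <;> fin_cases f <;> simp <;> ring

set_option maxHeartbeats 1000000 in
/-- The first modified Yang–Baxter equation for `Rconst` at arbitrary nonzero parameters. -/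
theorem Rconst_modified_yangBaxter {ε q : ℂ} (hε : ε ≠ 0) (hq : q ≠ 0) (p : ℕ) :
    op12 (Rconst ε q 0) * op13 (Rconst ε q p) * op23 (Rconst ε q 0) =
      op23 (Rconst ε q p) * op13 (Rconst ε q 0) * op12 (Rconst ε q p) := by
  have h : ε ^ p ≠ 0 := pow_ne_zero p hε
  ext ⟨a, b, c⟩ ⟨d, e, f⟩
  rw [op12_mul_op13_mul_op23_apply, op23_mul_op13_mul_op12_apply]
  fin_cases a <;> fin_cases b <;> fin_cases c <;> fin_cases d <;> fin_cases e <;> fin_cases f <;>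
    simp [Rconst] <;> field_simp <;> ring

/-- First modified Yang–Baxter equation for the constant matrices `R = R^{ι^0}`
and `S = R^{ι^p}`:  `R₁₂·S₁₃·R₂₃ = S₂₃·R₁₃·S₁₂` on `ℂ²⊗ℂ²⊗ℂ²`. -/
theorem stmt2 (P : ℕ) (hP : 1 ≤ P) (p : ℕ) (q : ℂ) (hq : q ≠ 0)
    (ε : ℂ) (hε : ε = Complex.exp (2 * Real.pi * Complex.I / P)) :
    op12 (Rconst ε q 0) * op13 (Rconst ε q p) * op23 (Rconst ε q 0) =
      op23 (Rconst ε q p) * op13 (Rconst ε q 0) * op12 (Rconst ε q p) := by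
  exact Rconst_modified_yangBaxter (hε ▸ Complex.exp_ne_zero _) hq p
end

section
/- For every integer P ≥ 1, every p ∈ ℕ and every q ∈ ℂ with q ≠ 0, the constant matrices R and S = R^{ι^p} satisfy the third modified Yang–Baxter equation R₁₂·(S₃₁)^{−1}·R₂₃ − (R₂₁)^{−1}·S₁₃·(R₃₂)^{−1} = S₂₃·(R₃₁)^{−1}·S₁₂ − (S₃₂)^{−1}·R₁₃·(S₂₁)^{−1}, an equality of operators on ℂ²⊗ℂ²⊗ℂ² (all the indicated operators on ℂ²⊗ℂ²⊗ℂ² are invertible since q ≠ 0, and the inverses are operator inverses). -/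
open Complex

/-- The sixteen entries of the constant `R`-matrix. -/
theorem Rconst_entries (ε q : ℂ) (p : ℕ) :
    Rconst ε q p (0, 0) (0, 0) = q ∧
    Rconst ε q p (0, 0) (0, 1) = 0 ∧
    Rconst ε q p (0, 0) (1, 0) = 0 ∧
    Rconst ε q p (0, 0) (1, 1) = 0 ∧
    Rconst ε q p (0, 1) (0, 0) = 0 ∧
    Rconst ε q p (0, 1) (0, 1) = ε ^ p ∧
    Rconst ε q p (0, 1) (1, 0) = 0 ∧
    Rconst ε q p (0, 1) (1, 1) = 0 ∧
    Rconst ε q p (1, 0) (0, 0) = 0 ∧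
    Rconst ε q p (1, 0) (0, 1) = q - q⁻¹ ∧
    Rconst ε q p (1, 0) (1, 0) = (ε ^ p)⁻¹ ∧
    Rconst ε q p (1, 0) (1, 1) = 0 ∧
    Rconst ε q p (1, 1) (0, 0) = 0 ∧
    Rconst ε q p (1, 1) (0, 1) = 0 ∧
    Rconst ε q p (1, 1) (1, 0) = 0 ∧
    Rconst ε q p (1, 1) (1, 1) = q := by
  simp [Rconst]

/-- Inverting the constant `R`-matrix amounts to inverting both of its parameters. -/
theorem Rconst_mul_Rconst_inv {ε q : ℂ} (hε : ε ≠ 0) (hq : q ≠ 0) (p : ℕ) :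
    Rconst ε q p * Rconst ε⁻¹ q⁻¹ p = 1 := by
  ext ⟨i, j⟩ ⟨k, l⟩
  fin_cases i <;> fin_cases j <;> fin_cases k <;> fin_cases l <;>
    simp [Rconst_entries, Matrix.mul_apply, Fintype.sum_prod_type, hε, hq]
  ring

theorem op21_mul (X Y : Matrix V2 V2 ℂ) : op21 X * op21 Y = op21 (X * Y) := by
  ext ⟨i, j, k⟩ ⟨l, m, n⟩
  fin_cases k <;> fin_cases n <;>
    simp [op21, Matrix.mul_apply, Fintype.sum_prod_type] <;> ring

theorem op31_mul (X Y : Matrix V2 V2 ℂ) : op31 X * op31 Y = op31 (X * Y) := by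
  ext ⟨i, j, k⟩ ⟨l, m, n⟩
  fin_cases j <;> fin_cases m <;>
    simp [op31, Matrix.mul_apply, Fintype.sum_prod_type] <;> ring

theorem op32_mul (X Y : Matrix V2 V2 ℂ) : op32 X * op32 Y = op32 (X * Y) := by
  ext ⟨i, j, k⟩ ⟨l, m, n⟩
  fin_cases i <;> fin_cases l <;>
    simp [op32, Matrix.mul_apply, Fintype.sum_prod_type] <;> ring

theorem op21_one : op21 1 = 1 := by
  ext ⟨i, j, k⟩ ⟨l, m, n⟩
  simp only [op21, Matrix.of_apply, Matrix.one_apply, Prod.mk.injEq]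
  split_ifs <;> simp_all

theorem op31_one : op31 1 = 1 := by
  ext ⟨i, j, k⟩ ⟨l, m, n⟩
  simp only [op31, Matrix.of_apply, Matrix.one_apply, Prod.mk.injEq]
  split_ifs <;> simp_all

theorem op32_one : op32 1 = 1 := by
  ext ⟨i, j, k⟩ ⟨l, m, n⟩
  simp only [op32, Matrix.of_apply, Matrix.one_apply, Prod.mk.injEq]
  split_ifs <;> simp_all

theorem op21_Rconst_inv {ε q : ℂ} (hε : ε ≠ 0) (hq : q ≠ 0) (p : ℕ) :
    (op21 (Rconst ε q p))⁻¹ = op21 (Rconst ε⁻¹ q⁻¹ p) :=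
  Matrix.inv_eq_right_inv <| by rw [op21_mul, Rconst_mul_Rconst_inv hε hq, op21_one]

theorem op31_Rconst_inv {ε q : ℂ} (hε : ε ≠ 0) (hq : q ≠ 0) (p : ℕ) :
    (op31 (Rconst ε q p))⁻¹ = op31 (Rconst ε⁻¹ q⁻¹ p) :=
  Matrix.inv_eq_right_inv <| by rw [op31_mul, Rconst_mul_Rconst_inv hε hq, op31_one]

theorem op32_Rconst_inv {ε q : ℂ} (hε : ε ≠ 0) (hq : q ≠ 0) (p : ℕ) :
    (op32 (Rconst ε q p))⁻¹ = op32 (Rconst ε⁻¹ q⁻¹ p) :=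
  Matrix.inv_eq_right_inv <| by rw [op32_mul, Rconst_mul_Rconst_inv hε hq, op32_one]

set_option maxHeartbeats 4000000 in
/-- Third modified Yang–Baxter equation for the constant matrices `R = R^{ι^0}`
and `S = R^{ι^p}`:
`R₁₂·(S₃₁)⁻¹·R₂₃ − (R₂₁)⁻¹·S₁₃·(R₃₂)⁻¹ = S₂₃·(R₃₁)⁻¹·S₁₂ − (S₃₂)⁻¹·R₁₃·(S₂₁)⁻¹`
on `ℂ²⊗ℂ²⊗ℂ²`, the inverses being operator inverses. -/
theorem stmt4 (P : ℕ) (hP : 1 ≤ P) (p : ℕ) (q : ℂ) (hq : q ≠ 0)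
    (ε : ℂ) (hε : ε = Complex.exp (2 * Real.pi * Complex.I / P)) :
    op12 (Rconst ε q 0) * (op31 (Rconst ε q p))⁻¹ * op23 (Rconst ε q 0) -
        (op21 (Rconst ε q 0))⁻¹ * op13 (Rconst ε q p) * (op32 (Rconst ε q 0))⁻¹ =
      op23 (Rconst ε q p) * (op31 (Rconst ε q 0))⁻¹ * op12 (Rconst ε q p) -
        (op32 (Rconst ε q p))⁻¹ * op13 (Rconst ε q 0) * (op21 (Rconst ε q p))⁻¹ := by
  have hε0 : ε ≠ 0 := hε ▸ Complex.exp_ne_zero _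
  simp only [op21_Rconst_inv hε0 hq, op31_Rconst_inv hε0 hq, op32_Rconst_inv hε0 hq]
  have ha : ε ^ p ≠ 0 := pow_ne_zero p hε0
  ext ⟨i, j, k⟩ ⟨l, m, n⟩
  fin_cases i <;> fin_cases j <;> fin_cases k <;>
    fin_cases l <;> fin_cases m <;> fin_cases n <;>
    simp [op12, op13, op23, op21, op31, op32, Rconst_entries, Matrix.mul_apply,
      Fintype.sum_prod_type] <;> field_simp <;> ring
end

section
/- For every λ ∈ ℂ, every integer P ≥ 1, every p ∈ ℕ and all w, v ∈ ℂ, the spectral-parameter dependent matrices satisfy the modified (coupled) Yang–Baxter equation R₁₂(w−v)·R^{ι^p}₁₃(w)·R₂₃(v) = R^{ι^p}₂₃(v)·R₁₃(w)·R^{ι^p}₁₂(w−v), an equality of operators on ℂ²⊗ℂ²⊗ℂ². -/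
open Complex

set_option maxHeartbeats 4000000 in
/-- Modified (coupled) Yang–Baxter equation for the spectral-parameter
dependent matrices:
`R₁₂(w−v)·R^{ι^p}₁₃(w)·R₂₃(v) = R^{ι^p}₂₃(v)·R₁₃(w)·R^{ι^p}₁₂(w−v)`
on `ℂ²⊗ℂ²⊗ℂ²`. -/
theorem stmt6 (P : ℕ) (hP : 1 ≤ P) (lam : ℂ) (p : ℕ) (w v : ℂ)
    (ε : ℂ) (hε : ε = Complex.exp (2 * Real.pi * Complex.I / P)) :
    op12 (Rspec ε lam 0 (w - v)) * op13 (Rspec ε lam p w) * op23 (Rspec ε lam 0 v) =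
      op23 (Rspec ε lam p v) * op13 (Rspec ε lam 0 w) * op12 (Rspec ε lam p (w - v)) := by
  have ha : ε ^ p ≠ 0 := pow_ne_zero p (hε ▸ Complex.exp_ne_zero _)
  ext ⟨i, j, k⟩ ⟨i', j', k'⟩
  fin_cases i <;> fin_cases j <;> fin_cases k <;> fin_cases i' <;> fin_cases j' <;>
    fin_cases k' <;>
    simp [Matrix.mul_apply, Fintype.sum_prod_type, Fin.sum_univ_two, op12, op13, op23, Rspec]
  all_goals
    generalize ε ^ p = a at *
    simp only [Complex.sin, add_mul, sub_mul, neg_add, neg_sub, neg_mul,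
      mul_comm Complex.I, Complex.exp_add, Complex.exp_sub, Complex.exp_neg]
    have hx := Complex.exp_ne_zero (lam * Complex.I)
    have hy := Complex.exp_ne_zero (w * Complex.I)
    have hz := Complex.exp_ne_zero (v * Complex.I)
    generalize Complex.exp (lam * Complex.I) = x at *
    generalize Complex.exp (w * Complex.I) = y at *
    generalize Complex.exp (v * Complex.I) = z at *
    field_simp <;> ring
end

section
/- Under the stated hypotheses, the composite elements satisfy the U_q(gl(2)) commutator relation ℰ·ℱ − ℱ·ℰ = (q−q^{−1})^{−1}·( 𝒦₂ − 𝒦₋₂·𝒦₋₁ ), as an equality in the product ring A^P. -/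
/-- `ℰ`, with `p`-th component `(q−q⁻¹)⁻¹·ε^{−p(p−3)/2}·q^p·e_p` in the product
ring `A^P`. -/
noncomputable def calE (P : ℕ) (q ε : ℂ) {A : Type*} [Ring A] [Algebra ℂ A]
    (e : Fin P → A) : Fin P → A :=
  fun p =>
    ((q - q⁻¹)⁻¹ * ε ^ ((-(((p : ℕ) : ℤ) * (((p : ℕ) : ℤ) - 3))) / 2) * q ^ (p : ℕ)) • e p

/-- `ℱ`, with `p`-th component `(q−q⁻¹)⁻¹·ε^{p(p−1)/2}·q^{−p−1}·f_p` in the product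
ring `A^P`. -/
noncomputable def calF (P : ℕ) (q ε : ℂ) {A : Type*} [Ring A] [Algebra ℂ A]
    (f : Fin P → A) : Fin P → A :=
  fun p =>
    ((q - q⁻¹)⁻¹ * ε ^ ((((p : ℕ) : ℤ) * (((p : ℕ) : ℤ) - 1)) / 2) *
        q ^ (-((p : ℕ) : ℤ) - 1)) • f p

/-- Composite Cartan element with `p`-th component `ε^p·k_p` (used for both `𝒦₂`
and `𝒦₋₂`). -/
noncomputable def calK (P : ℕ) (ε : ℂ) {A : Type*} [Ring A] [Algebra ℂ A]
    (k : Fin P → A) : Fin P → A :=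
  fun p => (ε ^ (p : ℕ)) • k p

theorem exponent_sum_eq (n : ℤ) : -(n * (n - 3)) / 2 + n * (n - 1) / 2 = n := by
  obtain ⟨a, ha⟩ : (2 : ℤ) ∣ n * (n - 1) := (Int.even_mul_pred_self n).two_dvd
  have hb : -(n * (n - 3)) = 2 * (n - a) := by linear_combination -ha
  rw [ha, hb, Int.mul_ediv_cancel_left _ two_ne_zero, Int.mul_ediv_cancel_left _ two_ne_zero]
  ring

theorem calE_calF_coeff_mul {q ε : ℂ} (hq : q ≠ 0) (hq2 : q ^ 2 ≠ 1) (hε : ε ≠ 0) (n : ℕ) :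
    ((q - q⁻¹)⁻¹ * ε ^ ((-((n : ℤ) * ((n : ℤ) - 3))) / 2) * q ^ n) *
      ((q - q⁻¹)⁻¹ * ε ^ (((n : ℤ) * ((n : ℤ) - 1)) / 2) * q ^ (-(n : ℤ) - 1)) * (q ^ 2 - 1) =
      (q - q⁻¹)⁻¹ * ε ^ n := by
  have hεn : ε ^ ((-((n : ℤ) * ((n : ℤ) - 3))) / 2) * ε ^ (((n : ℤ) * ((n : ℤ) - 1)) / 2) =
      ε ^ n := by
    rw [← zpow_add₀ hε, exponent_sum_eq, zpow_natCast]
  have hqn : q ^ n * q ^ (-(n : ℤ) - 1) = q⁻¹ := by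
    rw [← zpow_natCast, ← zpow_add₀ hq, ← zpow_neg_one]
    congr 1
    ring
  have hd : q⁻¹ * (q ^ 2 - 1) = q - q⁻¹ := by field_simp
  have hd0 : q - q⁻¹ ≠ 0 := by
    rw [← hd]
    exact mul_ne_zero (inv_ne_zero hq) (sub_ne_zero.mpr hq2)
  calc
    _ = (q - q⁻¹)⁻¹ * (q - q⁻¹)⁻¹ *
        (ε ^ ((-((n : ℤ) * ((n : ℤ) - 3))) / 2) * ε ^ (((n : ℤ) * ((n : ℤ) - 1)) / 2)) *
        (q ^ n * q ^ (-(n : ℤ) - 1) * (q ^ 2 - 1)) := by ring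
    _ = (q - q⁻¹)⁻¹ * ε ^ n * ((q - q⁻¹)⁻¹ * (q - q⁻¹)) := by
      rw [hεn, hqn, hd]
      ring
    _ = (q - q⁻¹)⁻¹ * ε ^ n := by rw [inv_mul_cancel₀ hd0, mul_one]

/-- The composite operators satisfy the `U_q(gl(2))` commutator relation
`ℰℱ − ℱℰ = (q−q⁻¹)⁻¹·( 𝒦₂ − 𝒦₋₂𝒦₋₁ )` in the product ring `A^P`. -/
theorem stmt9 (P : ℕ) (hP : 1 ≤ P)
    (ε : ℂ) (hε : ε = Complex.exp (2 * Real.pi * Complex.I / P))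
    (q : ℂ) (hq : q ≠ 0) (hq2 : q ^ 2 ≠ 1)
    {A : Type*} [Ring A] [Algebra ℂ A]
    (e f k1 k2 l2 : Fin P → A)
    (hk1e : ∀ p, k1 p * e p = (q ^ 2)⁻¹ • (e p * k1 p))
    (hk2e : ∀ p, k2 p * e p = (q ^ 2)⁻¹ • (e p * k2 p))
    (hl2e : ∀ p, l2 p * e p = e p * l2 p)
    (hk1f : ∀ p, k1 p * f p = (q ^ 2) • (f p * k1 p))
    (hk2f : ∀ p, k2 p * f p = (q ^ 2) • (f p * k2 p))
    (hl2f : ∀ p, l2 p * f p = f p * l2 p)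
    (hef : ∀ p, e p * f p - f p * e p = (q ^ 2 - 1) • (k2 p - l2 p * k1 p)) :
    calE P q ε e * calF P q ε f - calF P q ε f * calE P q ε e =
      (q - q⁻¹)⁻¹ • (calK P ε k2 - calK P ε l2 * k1) := by
  have hε0 : ε ≠ 0 := hε ▸ Complex.exp_ne_zero _
  funext p
  simp only [calE, calF, calK, Pi.sub_apply, Pi.mul_apply, Pi.smul_apply]
  rw [smul_mul_smul_comm, smul_mul_smul_comm, mul_comm (_ * q ^ (-((p : ℕ) : ℤ) - 1)),
    ← smul_sub, hef, smul_smul, calE_calF_coeff_mul hq hq2 hε0, smul_mul_assoc, ← smul_sub,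
    smul_smul]
end

section
/- Under the stated hypotheses, the composite elements fulfil, for every p ∈ ℤ/P, the commutation relations k₋₁^(p)·e^(p) = q^{−2}·e^(p)·k₋₁^(p), k₂^(p)·e^(p) = q^{−2}·e^(p)·k₂^(p), k₋₂^(p)·e^(p) = e^(p)·k₋₂^(p), k₋₁^(p)·f^(p) = q²·f^(p)·k₋₁^(p), k₂^(p)·f^(p) = q²·f^(p)·k₂^(p), and k₋₂^(p)·f^(p) = f^(p)·k₋₂^(p). -/
/-- Composite element `e^(p) = E^(p−1)·(K₊₁^(p−1))⁻¹` (also used for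
`f^(p) = F^(p−1)·(K₋₁^(p−1))⁻¹`). -/
noncomputable def comp1 (P : ℕ) {A : Type*} [Ring A] (E K1 : ZMod P → A) :
    ZMod P → A :=
  fun p => E (p - 1) * Ring.inverse (K1 (p - 1))

/-- Commuting two quotients `X' * K'⁻¹` and `Y' * L'⁻¹` whose factors satisfy exchange relations
with shifted partners. -/
theorem mul_inverse_exchange {𝕜 A : Type*} [Field 𝕜] [Ring A] [Algebra 𝕜 A]
    {X X' Y Y' K K' L L' : A} {a b d : 𝕜} (ha : a ≠ 0) (hd : d ≠ 0)
    (hK : IsUnit K) (hK' : IsUnit K') (hL : IsUnit L) (hL' : IsUnit L')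
    (hKY : K' * Y = a • (Y' * K)) (hXY : X' * Y = b • (Y' * X))
    (hLX : L' * X = d • (X' * L)) (hLK : L' * K = K' * L) :
    X' * Ring.inverse K' * (Y' * Ring.inverse L') =
      (b * d / a) • (Y' * Ring.inverse L' * (X' * Ring.inverse K')) := by
  obtain ⟨K, rfl⟩ := hK
  obtain ⟨K', rfl⟩ := hK'
  obtain ⟨L, rfl⟩ := hL
  obtain ⟨L', rfl⟩ := hL'
  simp only [Ring.inverse_unit]
  have hY : (↑K'⁻¹ : A) * Y' = a⁻¹ • (Y * ↑K⁻¹) := by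
    rw [Units.inv_mul_eq_iff_eq_mul, mul_smul_comm, ← mul_assoc, hKY, smul_mul_assoc,
      Units.mul_inv_cancel_right, inv_smul_smul₀ ha]
  have hX : (↑L'⁻¹ : A) * X' = d⁻¹ • (X * ↑L⁻¹) := by
    rw [Units.inv_mul_eq_iff_eq_mul, mul_smul_comm, ← mul_assoc, hLX, smul_mul_assoc,
      Units.mul_inv_cancel_right, inv_smul_smul₀ hd]
  have hinv : (↑K⁻¹ : A) * ↑L'⁻¹ = ↑L⁻¹ * ↑K'⁻¹ := by
    have h : L' * K = K' * L := Units.ext hLK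
    simpa using congrArg (fun u : Aˣ => (↑u⁻¹ : A)) h
  have hl : X' * ↑K'⁻¹ * (Y' * ↑L'⁻¹) = (b / a) • (Y' * X * (↑K⁻¹ * ↑L'⁻¹)) := by
    rw [mul_assoc X', ← mul_assoc _ Y', hY, smul_mul_assoc, mul_smul_comm, mul_assoc Y,
      ← mul_assoc X', hXY, smul_mul_assoc, smul_smul, div_eq_inv_mul]
  have hr : Y' * ↑L'⁻¹ * (X' * ↑K'⁻¹) = d⁻¹ • (Y' * X * (↑L⁻¹ * ↑K'⁻¹)) := by
    rw [mul_assoc Y', ← mul_assoc _ X', hX, smul_mul_assoc, mul_smul_comm, mul_assoc X,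
      ← mul_assoc Y']
  rw [hl, hr, hinv, smul_smul]
  congr 1
  field_simp

/-- For `x ^ n = 1`, the power `x ^ p.val` with `p : ZMod n` is compatible with `p ↦ p + 1`. -/
theorem pow_zmod_val_add_one {M : Type*} [Monoid M] {n : ℕ} [NeZero n] {x : M} (hx : x ^ n = 1)
    (p : ZMod n) : x ^ (p + 1).val = x ^ p.val * x := by
  rw [← pow_succ, ZMod.val_add, ZMod.val_one_eq_one_mod, Nat.add_mod_mod,
    ← pow_mod_orderOf, Nat.mod_mod_of_dvd _ (orderOf_dvd_of_pow_eq_one hx), pow_mod_orderOf]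

/-- The composite elements fulfil, for every `p ∈ ℤ/P`, the commutation
relations `k₋₁^(p)e^(p) = q⁻²e^(p)k₋₁^(p)`, `k₂^(p)e^(p) = q⁻²e^(p)k₂^(p)`,
`k₋₂^(p)e^(p) = e^(p)k₋₂^(p)`, `k₋₁^(p)f^(p) = q²f^(p)k₋₁^(p)`,
`k₂^(p)f^(p) = q²f^(p)k₂^(p)`, `k₋₂^(p)f^(p) = f^(p)k₋₂^(p)`. -/
theorem stmt11 (P : ℕ) (hP : 1 ≤ P)
    (ε : ℂ) (hε : ε = Complex.exp (2 * Real.pi * Complex.I / P))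
    (q : ℂ) (hq : q ≠ 0)
    {A : Type*} [Ring A] [Algebra ℂ A]
    (E F K1 L1 K2 L2 : ZMod P → A)
    (hK1 : ∀ p, IsUnit (K1 p)) (hL1 : ∀ p, IsUnit (L1 p))
    (hK2 : ∀ p, IsUnit (K2 p)) (hL2 : ∀ p, IsUnit (L2 p))
    (h1 : ∀ p, K1 (p + 1) * L1 p = L1 (p + 1) * K1 p)
    (h2 : ∀ p, K2 (p + 1) * L2 p = L2 (p + 1) * K2 p)
    (h3 : ∀ p, K1 (p + 1) * K2 p = ε • (K2 (p + 1) * K1 p))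
    (h4 : ∀ p, L1 (p + 1) * L2 p = ε • (L2 (p + 1) * L1 p))
    (h5 : ∀ p, K1 (p + 1) * L2 p = ε • (L2 (p + 1) * K1 p))
    (h6 : ∀ p, K2 (p + 1) * L1 p = ε⁻¹ • (L1 (p + 1) * K2 p))
    (h7 : ∀ p, K1 (p + 1) * E p = ((ε ^ p.val)⁻¹ * q) • (E (p + 1) * K1 p))
    (h8 : ∀ p, L1 (p + 1) * E p = ((ε ^ p.val)⁻¹ * q⁻¹) • (E (p + 1) * L1 p))
    (h9 : ∀ p, K2 (p + 1) * E p = ((ε ^ (p + 1).val)⁻¹ * q⁻¹) • (E (p + 1) * K2 p))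
    (h10 : ∀ p, L2 (p + 1) * E p = ((ε ^ (p + 1).val)⁻¹ * q) • (E (p + 1) * L2 p))
    (h11 : ∀ p, K1 (p + 1) * F p = (ε ^ (p + 1).val * q⁻¹) • (F (p + 1) * K1 p))
    (h12 : ∀ p, L1 (p + 1) * F p = (ε ^ (p + 1).val * q) • (F (p + 1) * L1 p))
    (h13 : ∀ p, K2 (p + 1) * F p = (ε ^ p.val * q) • (F (p + 1) * K2 p))
    (h14 : ∀ p, L2 (p + 1) * F p = (ε ^ p.val * q⁻¹) • (F (p + 1) * L2 p)) :
    ∀ p : ZMod P,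
      comp1 P L1 K1 p * comp1 P E K1 p = (q ^ 2)⁻¹ • (comp1 P E K1 p * comp1 P L1 K1 p) ∧
      comp1 P K2 K1 p * comp1 P E K1 p = (q ^ 2)⁻¹ • (comp1 P E K1 p * comp1 P K2 K1 p) ∧
      comp1 P L2 K1 p * comp1 P E K1 p = comp1 P E K1 p * comp1 P L2 K1 p ∧
      comp1 P L1 K1 p * comp1 P F L1 p = (q ^ 2) • (comp1 P F L1 p * comp1 P L1 K1 p) ∧
      comp1 P K2 K1 p * comp1 P F L1 p = (q ^ 2) • (comp1 P F L1 p * comp1 P K2 K1 p) ∧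
      comp1 P L2 K1 p * comp1 P F L1 p = comp1 P F L1 p * comp1 P L2 K1 p := by
  have hP0 : P ≠ 0 := Nat.one_le_iff_ne_zero.mp hP
  have : NeZero P := ⟨hP0⟩
  have hε0 : ε ≠ 0 := hε ▸ Complex.exp_ne_zero _
  have hεP : ε ^ P = 1 := hε ▸ (Complex.isPrimitiveRoot_exp P hP0).pow_eq_one
  intro p
  obtain ⟨s, rfl⟩ : ∃ s, p = s + 1 + 1 := ⟨p - 1 - 1, by ring⟩
  have hs := pow_zmod_val_add_one hεP s
  have hw : ε ^ s.val ≠ 0 := pow_ne_zero _ hε0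
  have h6' : L1 (s + 1) * K2 s = ε • (K2 (s + 1) * L1 s) := by
    rw [h6, smul_inv_smul₀ hε0]
  have e7 := h7 s
  have e8 := h8 s
  have e9 := h9 s
  have e10 := h10 s
  have e11 := h11 s
  have e12 := h12 s
  have e13 := h13 s
  have e14 := h14 s
  rw [hs] at e9 e10 e11 e12
  generalize ε ^ s.val = w at *
  have ha : w⁻¹ * q ≠ 0 := by positivity
  have hb : w * ε * q⁻¹ ≠ 0 := by positivity
  have hKK : K1 (s + 1) * L1 s = (1 : ℂ) • (L1 (s + 1) * K1 s) := by rw [one_smul, h1]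
  have hLL : L1 (s + 1) * L1 s = (1 : ℂ) • (L1 (s + 1) * L1 s) := (one_smul _ _).symm
  simp only [comp1, add_sub_cancel_right]
  refine ⟨?_, ?_, ?_, ?_, ?_, ?_⟩
  · rw [mul_inverse_exchange ha one_ne_zero (hK1 s) (hK1 _) (hK1 s) (hK1 _) e7 e8 hKK rfl]
    congr 1
    field_simp
  · rw [mul_inverse_exchange ha hε0 (hK1 s) (hK1 _) (hK1 s) (hK1 _) e7 e9 (h3 s) rfl]
    congr 1
    field_simp
  · rw [mul_inverse_exchange ha hε0 (hK1 s) (hK1 _) (hK1 s) (hK1 _) e7 e10 (h5 s) rfl]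
    convert one_smul ℂ _ using 2
    field_simp
  · rw [mul_inverse_exchange hb one_ne_zero (hK1 s) (hK1 _) (hL1 s) (hL1 _) e11 e12 hLL
      (h1 s).symm]
    congr 1
    field_simp
  · rw [mul_inverse_exchange hb hε0 (hK1 s) (hK1 _) (hL1 s) (hL1 _) e11 e13 h6' (h1 s).symm]
    congr 1
    field_simp
  · rw [mul_inverse_exchange hb hε0 (hK1 s) (hK1 _) (hL1 s) (hL1 _) e11 e14 (h4 s) (h1 s).symm]
    convert one_smul ℂ _ using 2
    field_simp
end

section
/- Under the stated hypotheses, the Cartan generator K₊₁ intertwines the composite elements with a shift of the grading index: for every p ∈ ℤ/P, K₊₁^(p)·e^(p) = ε^{−p+1}q·e^(p+1)·K₊₁^(p), K₊₁^(p)·f^(p) = ε^{p}q^{−1}·f^(p+1)·K₊₁^(p), K₊₁^(p)·k₋₁^(p) = k₋₁^(p+1)·K₊₁^(p), K₊₁^(p)·k₂^(p) = ε·k₂^(p+1)·K₊₁^(p), and K₊₁^(p)·k₋₂^(p) = ε·k₋₂^(p+1)·K₊₁^(p). -/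
/-- Inverting a power of a `P`-th root of unity negates its exponent modulo `P`. -/
lemma inv_pow_zmod_val {M : Type*} [DivisionRing M] {P : ℕ} [NeZero P] {ε : M} (h : ε ^ P = 1)
    (a : ZMod P) : (ε ^ a.val)⁻¹ = ε ^ (-a).val := by
  refine inv_eq_of_mul_eq_one_right ?_
  rw [← pow_add, pow_eq_pow_mod _ h, ← ZMod.val_add, add_neg_cancel, ZMod.val_zero, pow_zero]

/-- If `X` shifts `Y` up to the scalar `c` and shifts `L` exactly, then it shifts the composite
of `Y` and `L` up to `c`. -/
lemma mul_comp1_eq_smul {R A : Type*} [CommRing R] [Ring A] [Algebra R A] {P : ℕ}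
    {X Y L : ZMod P → A} (hL : ∀ p, IsUnit (L p)) {p : ZMod P} {c : R}
    (hY : X p * Y (p - 1) = c • (Y p * X (p - 1)))
    (hX : X p * L (p - 1) = L p * X (p - 1)) :
    X p * comp1 P Y L p = c • (comp1 P Y L (p + 1) * X p) := by
  have key : X (p - 1) * Ring.inverse (L (p - 1)) = Ring.inverse (L p) * X p := by
    rw [← (hL (p - 1)).mul_left_inj, mul_assoc, Ring.inverse_mul_cancel _ (hL _), mul_one,
      mul_assoc, hX, Ring.inverse_mul_cancel_left _ _ (hL p)]
  simp only [comp1, add_sub_cancel_right]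
  rw [← mul_assoc, hY, smul_mul_assoc, mul_assoc, key, mul_assoc]

/-- The Cartan generator `K₊₁` intertwines the composite elements with a shift
of the grading index: `K₊₁^(p)e^(p) = ε^{−p+1}q·e^(p+1)K₊₁^(p)`,
`K₊₁^(p)f^(p) = ε^{p}q⁻¹·f^(p+1)K₊₁^(p)`, `K₊₁^(p)k₋₁^(p) = k₋₁^(p+1)K₊₁^(p)`,
`K₊₁^(p)k₂^(p) = ε·k₂^(p+1)K₊₁^(p)`, `K₊₁^(p)k₋₂^(p) = ε·k₋₂^(p+1)K₊₁^(p)`. -/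
theorem stmt12 (P : ℕ) (hP : 1 ≤ P)
    (ε : ℂ) (hε : ε = Complex.exp (2 * Real.pi * Complex.I / P))
    (q : ℂ) (hq : q ≠ 0)
    {A : Type*} [Ring A] [Algebra ℂ A]
    (E F K1 L1 K2 L2 : ZMod P → A)
    (hK1 : ∀ p, IsUnit (K1 p)) (hL1 : ∀ p, IsUnit (L1 p))
    (hK2 : ∀ p, IsUnit (K2 p)) (hL2 : ∀ p, IsUnit (L2 p))
    (h1 : ∀ p, K1 (p + 1) * L1 p = L1 (p + 1) * K1 p)
    (h2 : ∀ p, K2 (p + 1) * L2 p = L2 (p + 1) * K2 p)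
    (h3 : ∀ p, K1 (p + 1) * K2 p = ε • (K2 (p + 1) * K1 p))
    (h4 : ∀ p, L1 (p + 1) * L2 p = ε • (L2 (p + 1) * L1 p))
    (h5 : ∀ p, K1 (p + 1) * L2 p = ε • (L2 (p + 1) * K1 p))
    (h6 : ∀ p, K2 (p + 1) * L1 p = ε⁻¹ • (L1 (p + 1) * K2 p))
    (h7 : ∀ p, K1 (p + 1) * E p = ((ε ^ p.val)⁻¹ * q) • (E (p + 1) * K1 p))
    (h8 : ∀ p, L1 (p + 1) * E p = ((ε ^ p.val)⁻¹ * q⁻¹) • (E (p + 1) * L1 p))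
    (h9 : ∀ p, K2 (p + 1) * E p = ((ε ^ (p + 1).val)⁻¹ * q⁻¹) • (E (p + 1) * K2 p))
    (h10 : ∀ p, L2 (p + 1) * E p = ((ε ^ (p + 1).val)⁻¹ * q) • (E (p + 1) * L2 p))
    (h11 : ∀ p, K1 (p + 1) * F p = (ε ^ (p + 1).val * q⁻¹) • (F (p + 1) * K1 p))
    (h12 : ∀ p, L1 (p + 1) * F p = (ε ^ (p + 1).val * q) • (F (p + 1) * L1 p))
    (h13 : ∀ p, K2 (p + 1) * F p = (ε ^ p.val * q) • (F (p + 1) * K2 p))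
    (h14 : ∀ p, L2 (p + 1) * F p = (ε ^ p.val * q⁻¹) • (F (p + 1) * L2 p)) :
    ∀ p : ZMod P,
      K1 p * comp1 P E K1 p = (ε ^ (1 - p).val * q) • (comp1 P E K1 (p + 1) * K1 p) ∧
      K1 p * comp1 P F L1 p = (ε ^ p.val * q⁻¹) • (comp1 P F L1 (p + 1) * K1 p) ∧
      K1 p * comp1 P L1 K1 p = comp1 P L1 K1 (p + 1) * K1 p ∧
      K1 p * comp1 P K2 K1 p = ε • (comp1 P K2 K1 (p + 1) * K1 p) ∧
      K1 p * comp1 P L2 K1 p = ε • (comp1 P L2 K1 (p + 1) * K1 p) := by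
  have : NeZero P := ⟨by omega⟩
  have hεP : ε ^ P = 1 := by
    rw [hε]
    exact (Complex.isPrimitiveRoot_exp P (by omega)).pow_eq_one
  intro p
  have h1' := h1 (p - 1)
  have h3' := h3 (p - 1)
  have h5' := h5 (p - 1)
  have h7' := h7 (p - 1)
  have h11' := h11 (p - 1)
  rw [inv_pow_zmod_val hεP, neg_sub] at h7'
  rw [sub_add_cancel] at h1' h3' h5' h7' h11'
  refine ⟨mul_comp1_eq_smul hK1 h7' rfl, mul_comp1_eq_smul hL1 h11' h1', ?_,
    mul_comp1_eq_smul hK1 h3' rfl, mul_comp1_eq_smul hK1 h5' rfl⟩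
  simpa using mul_comp1_eq_smul (c := (1 : ℂ)) hK1 (by simpa using h1') rfl
end
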